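/- Let 1 ≤ s ≤ r+1 ≤ n with n ≥ 2, p = r − s + 1, S' = K[x_1,…,x_r], S'' = K[x_s,…,x_n], S = K[x_1,…,x_n], and let I ⊂ S' and J ⊂ S'' be monomial ideals. Then sdepth_S(IS + JS) ≥ min{ sdepth_S(IS), sdepth_{S''}(J) + sdepth_{S'}(S'/I) − p } = min{ sdepth_S(IS), sdepth_S(JS) + sdepth_S(S/IS) − n }. -/

import Mathlib

open MvPolynomial

/-- The `K`-subspace `m·K[Z]` of `S = K[x_0,…,x_{n-1}]`, where `m` is the monomial with
exponent vector `a` and `Z` is a set of variables: the span of all monomials `m·w`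
with `w` a monomial in the variables of `Z`. -/
noncomputable def StanleySpace (K : Type*) [Field K] {n : ℕ} (a : Fin n →₀ ℕ)
    (Z : Finset (Fin n)) : Submodule K (MvPolynomial (Fin n) K) :=
  Submodule.span K
    {p | ∃ c : Fin n →₀ ℕ, c.support ⊆ Z ∧ p = monomial (a + c) (1 : K)}

/-- `I` is a monomial ideal, i.e. an ideal generated by monomials. -/
def IsMonomialIdeal {K : Type*} [Field K] {n : ℕ}
    (I : Ideal (MvPolynomial (Fin n) K)) : Prop :=
  ∃ G : Set (Fin n →₀ ℕ), I = Ideal.span ((fun a => monomial a (1 : K)) '' G)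

/-- The `K`-subspace of `S` spanned by the monomials lying in `I` but not in `J`.
For monomial ideals `J ⊆ I` this is the canonical `K`-vector space representative
of the `ℤⁿ`-graded module `I/J` inside `S`. -/
noncomputable def monomialSpan (K : Type*) [Field K] {n : ℕ}
    (I J : Ideal (MvPolynomial (Fin n) K)) : Submodule K (MvPolynomial (Fin n) K) :=
  Submodule.span K
    {p | ∃ a : Fin n →₀ ℕ, p = monomial a (1 : K) ∧
      monomial a (1 : K) ∈ I ∧ monomial a (1 : K) ∉ J}

/-- The family `(a i, Z i), i = 1,…,r` is a Stanley decomposition of the module `I/J`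
(represented by the span of the monomials of `I \ J`): the Stanley spaces
`(a i)·K[Z i]` are independent and their (direct) sum is all of `I/J`. -/
def IsStanleyDecomp (K : Type*) [Field K] {n r : ℕ}
    (I J : Ideal (MvPolynomial (Fin n) K))
    (a : Fin r → (Fin n →₀ ℕ)) (Z : Fin r → Finset (Fin n)) : Prop :=
  iSupIndep (fun i => StanleySpace K (a i) (Z i)) ∧
    (⨆ i, StanleySpace K (a i) (Z i)) = monomialSpan K I J

/-- The Stanley depth `sdepth_S (I/J)` of the module `I/J`, where `J ⊆ I ⊆ S` are
monomial ideals: the largest `d` such that there is a Stanley decomposition of `I/J`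
all of whose Stanley spaces use at least `d` variables.  (As `ℕ∞`: the Stanley depth
of the zero module, which admits the empty decomposition, is `⊤`.)
`sdepth K I ⊥` is `sdepth_S I` and `sdepth K ⊤ I` is `sdepth_S (S/I)`. -/
noncomputable def sdepth (K : Type*) [Field K] {n : ℕ}
    (I J : Ideal (MvPolynomial (Fin n) K)) : ℕ∞ :=
  sSup {d : ℕ∞ | ∃ (r : ℕ) (a : Fin r → (Fin n →₀ ℕ)) (Z : Fin r → Finset (Fin n)),
    IsStanleyDecomp K I J a Z ∧ ∀ i, d ≤ ((Z i).card : ℕ∞)}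

/-- The depth `depth_S M` of an `S`-module `M` with respect to the maximal graded
ideal `(x_0,…,x_{n-1})`: the supremum of the lengths of `M`-regular sequences
contained in that ideal. -/
noncomputable def gradedDepth (K : Type*) [Field K] (n : ℕ) (M : Type*)
    [AddCommGroup M] [Module (MvPolynomial (Fin n) K) M] : ℕ∞ :=
  sSup {k : ℕ∞ | ∃ rs : List (MvPolynomial (Fin n) K), (rs.length : ℕ∞) = k ∧
    (∀ x ∈ rs, x ∈ Ideal.span (Set.range (X : Fin n → MvPolynomial (Fin n) K))) ∧
    RingTheory.Sequence.IsRegular M rs}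

/-- Extension of an ideal along an inclusion of polynomial rings induced by a map
of variables (`IS`, for `f` injective). -/
noncomputable def extIdeal {K : Type*} [Field K] {m n : ℕ} (f : Fin m → Fin n)
    (I : Ideal (MvPolynomial (Fin m) K)) : Ideal (MvPolynomial (Fin n) K) :=
  Ideal.map (rename f : MvPolynomial (Fin m) K →ₐ[K] MvPolynomial (Fin n) K) I

/-- The inclusion of the variables of `S'' = K[x_{r+1},…,x_n]` into those of
`S = K[x_1,…,x_n]` (variables indexed from `0`). -/
def sndEmbed {n r : ℕ} (h : r ≤ n) : Fin (n - r) → Fin n :=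
  fun i => ⟨r + i.1, by have := i.2; omega⟩

/-- The inclusion of the variables of `S'' = K[x_s,…,x_n]` into those of
`S = K[x_1,…,x_n]` (variables indexed from `0`). -/
def midEmbed {n s : ℕ} (hs : 1 ≤ s) (hsn : s ≤ n) : Fin (n + 1 - s) → Fin n :=
  fun i => ⟨s - 1 + i.1, by have := i.2; omega⟩

/-- The exponent vectors of the monomials in `a·K[Z]`. -/
def stanleyCone {n : ℕ} (a : Fin n →₀ ℕ) (Z : Finset (Fin n)) : Set (Fin n →₀ ℕ) :=
  {x | a ≤ x ∧ ∀ i ∉ Z, x i = a i}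

/-- The set `U` of exponent vectors is a finite disjoint union of cones, each of dimension at
least `d`. -/
def HasConePartition {n : ℕ} (U : Set (Fin n →₀ ℕ)) (d : ℕ) : Prop :=
  ∃ (r : ℕ) (a : Fin r → (Fin n →₀ ℕ)) (Z : Fin r → Finset (Fin n)),
    (∀ x, x ∈ U ↔ ∃ i, x ∈ stanleyCone (a i) (Z i)) ∧
    (∀ i j x, x ∈ stanleyCone (a i) (Z i) → x ∈ stanleyCone (a j) (Z j) → i = j) ∧
    ∀ i, d ≤ (Z i).card

/-- The exponent vectors of the monomials in an ideal. -/
def exponents {K : Type*} [Field K] {n : ℕ} (I : Ideal (MvPolynomial (Fin n) K)) :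
    Set (Fin n →₀ ℕ) :=
  {x | monomial x (1 : K) ∈ I}

theorem HasConePartition.of_finite {n d : ℕ} {U : Set (Fin n →₀ ℕ)} {ι : Type*} [Finite ι]
    (a : ι → (Fin n →₀ ℕ)) (Z : ι → Finset (Fin n))
    (hU : ∀ x, x ∈ U ↔ ∃ i, x ∈ stanleyCone (a i) (Z i))
    (hd : ∀ i j x, x ∈ stanleyCone (a i) (Z i) → x ∈ stanleyCone (a j) (Z j) → i = j)
    (hc : ∀ i, d ≤ (Z i).card) : HasConePartition U d := by
  let e := (Finite.equivFin ι).symm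
  refine ⟨Nat.card ι, a ∘ e, Z ∘ e, fun x => ?_, fun i j x hi hj => ?_, fun i => hc _⟩
  · rw [hU, ← e.exists_congr_right]
    rfl
  · exact e.injective (hd _ _ x hi hj)

theorem HasConePartition.mono {n d e : ℕ} {U : Set (Fin n →₀ ℕ)} (h : HasConePartition U d)
    (hed : e ≤ d) : HasConePartition U e := by
  obtain ⟨r, a, Z, hU, hd, hc⟩ := h
  exact ⟨r, a, Z, hU, hd, fun i => hed.trans (hc i)⟩

theorem StanleySpace_eq_restrictSupport (K : Type*) [Field K] {n : ℕ} (a : Fin n →₀ ℕ)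
    (Z : Finset (Fin n)) : StanleySpace K a Z = restrictSupport K (stanleyCone a Z) := by
  rw [restrictSupport_eq_span, StanleySpace]
  congr 1
  ext p
  constructor
  · rintro ⟨c, hc, rfl⟩
    refine ⟨a + c, ⟨le_self_add, fun i hi => ?_⟩, rfl⟩
    have : c i = 0 := by
      by_contra h
      exact hi (hc (Finsupp.mem_support_iff.2 h))
    simp [this]
  · rintro ⟨x, ⟨hx, hxZ⟩, rfl⟩
    refine ⟨x - a, fun i hi => ?_, ?_⟩
    · by_contra h
      simp [hxZ i h] at hi
    · rw [add_tsub_cancel_of_le hx]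

theorem monomialSpan_eq_restrictSupport (K : Type*) [Field K] {n : ℕ}
    (I J : Ideal (MvPolynomial (Fin n) K)) :
    monomialSpan K I J = restrictSupport K (exponents I \ exponents J) := by
  rw [restrictSupport_eq_span, monomialSpan]
  congr 1
  ext p
  constructor
  · rintro ⟨x, rfl, hI, hJ⟩
    exact ⟨x, ⟨hI, hJ⟩, rfl⟩
  · rintro ⟨x, ⟨hI, hJ⟩, rfl⟩
    exact ⟨x, rfl, hI, hJ⟩

theorem restrictSupport_iUnion (K : Type*) [Field K] {n : ℕ} {ι : Sort*}
    (T : ι → Set (Fin n →₀ ℕ)) :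
    restrictSupport K (⋃ i, T i) = ⨆ i, restrictSupport K (T i) := by
  simp only [restrictSupport_eq_span, Set.image_iUnion, Submodule.span_iUnion]

theorem restrictSupport_injective (K : Type*) [Field K] {n : ℕ} :
    Function.Injective (restrictSupport K : Set (Fin n →₀ ℕ) → _) := by
  intro s t h
  ext x
  have := SetLike.ext_iff.1 h (monomial x (1 : K))
  simpa [monomial_mem_restrictSupport] using this

theorem disjoint_restrictSupport (K : Type*) [Field K] {n : ℕ} {s t : Set (Fin n →₀ ℕ)} :
    Disjoint (restrictSupport K s) (restrictSupport K t) ↔ Disjoint s t := by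
  constructor
  · intro h
    rw [Set.disjoint_left]
    intro x hs ht
    have := Submodule.disjoint_def.1 h (monomial x (1 : K))
      ((monomial_mem_restrictSupport K).2 (.inl hs)) ((monomial_mem_restrictSupport K).2 (.inl ht))
    simp at this
  · intro h
    have := (basisMonomials (Fin n) K).linearIndependent.disjoint_span_image h
    simpa only [restrictSupport_eq_span, coe_basisMonomials] using this

theorem isStanleyDecomp_iff {K : Type*} [Field K] {n r : ℕ}
    {I J : Ideal (MvPolynomial (Fin n) K)} {a : Fin r → (Fin n →₀ ℕ)}
    {Z : Fin r → Finset (Fin n)} :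
    IsStanleyDecomp K I J a Z ↔
      (∀ x, x ∈ exponents I \ exponents J ↔ ∃ i, x ∈ stanleyCone (a i) (Z i)) ∧
      ∀ i j x, x ∈ stanleyCone (a i) (Z i) → x ∈ stanleyCone (a j) (Z j) → i = j := by
  simp only [IsStanleyDecomp, iSupIndep, StanleySpace_eq_restrictSupport,
    monomialSpan_eq_restrictSupport, ← restrictSupport_iUnion, disjoint_restrictSupport,
    (restrictSupport_injective K).eq_iff]
  rw [and_comm]
  refine and_congr ?_ ?_
  · rw [eq_comm, Set.ext_iff]
    simp only [Set.mem_iUnion]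
  · simp only [Set.disjoint_left, Set.mem_iUnion, not_exists]
    refine forall_congr' fun i => ⟨fun h j x hi hj => ?_, fun h x hi j hji hj => ?_⟩
    · by_contra hne
      exact h hi j (Ne.symm hne) hj
    · exact hji (h j x hi hj).symm

theorem IsMonomialIdeal.exists_bound {K : Type*} [Field K] {n : ℕ}
    {I : Ideal (MvPolynomial (Fin n) K)} (hI : IsMonomialIdeal I) :
    ∃ g : Fin n →₀ ℕ, ∀ h, g ≤ h → ∀ x, x ∈ exponents I ↔ x ⊓ h ∈ exponents I := by
  classical
  obtain ⟨G, rfl⟩ := hI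
  obtain ⟨F, hF, hspan⟩ := (Submodule.fg_span_iff_fg_span_finset_subset _).1
    (IsNoetherian.noetherian (Ideal.span ((fun a => monomial a (1 : K)) '' G)))
  obtain ⟨F', hF', rfl⟩ := Finset.subset_set_image_iff.1 hF
  have key : Ideal.span ((fun a => monomial a (1 : K)) '' G) =
      Ideal.span ((fun a => monomial a (1 : K)) '' (F' : Set (Fin n →₀ ℕ))) := by
    rw [← Finset.coe_image]
    exact hspan
  refine ⟨F'.sup id, fun h hh x => ?_⟩
  rw [key]
  simp only [exponents, Set.mem_ofPred_eq, mem_ideal_span_monomial_image,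
    support_monomial, one_ne_zero, if_false, Finset.mem_singleton, forall_eq, le_inf_iff]
  refine exists_congr fun s => and_congr_right fun hs => ?_
  exact ⟨fun hx => ⟨hx, (Finset.le_sup (f := id) hs).trans hh⟩, And.left⟩

theorem isMonomialIdeal_top {K : Type*} [Field K] {n : ℕ} :
    IsMonomialIdeal (⊤ : Ideal (MvPolynomial (Fin n) K)) :=
  ⟨{0}, by simp⟩

theorem isMonomialIdeal_bot {K : Type*} [Field K] {n : ℕ} :
    IsMonomialIdeal (⊥ : Ideal (MvPolynomial (Fin n) K)) :=
  ⟨∅, by simp⟩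

theorem exponents_top {K : Type*} [Field K] {n : ℕ} :
    exponents (⊤ : Ideal (MvPolynomial (Fin n) K)) = Set.univ := by
  ext; simp [exponents]

theorem exponents_bot {K : Type*} [Field K] {n : ℕ} :
    exponents (⊥ : Ideal (MvPolynomial (Fin n) K)) = ∅ := by
  ext; simp [exponents]

theorem hasConePartition_zero {K : Type*} [Field K] {n : ℕ}
    {I J : Ideal (MvPolynomial (Fin n) K)} (hI : IsMonomialIdeal I) (hJ : IsMonomialIdeal J) :
    HasConePartition (exponents I \ exponents J) 0 := by
  obtain ⟨g₁, hg₁⟩ := hI.exists_bound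
  obtain ⟨g₂, hg₂⟩ := hJ.exists_bound
  set g := g₁ ⊔ g₂
  have hg : ∀ x, x ∈ exponents I \ exponents J ↔ x ⊓ g ∈ exponents I \ exponents J := fun x =>
    and_congr (hg₁ g le_sup_left x) (not_congr (hg₂ g le_sup_right x))
  have hcone : ∀ c ≤ g, ∀ x, x ∈ stanleyCone c {i | c i = g i} ↔ x ⊓ g = c := by
    intro c hc x
    constructor
    · rintro ⟨h₁, h₂⟩
      ext i
      have := hc i
      have := h₁ i
      have := h₂ i
      simp only [Finset.mem_filter, Finset.mem_univ, true_and] at this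
      rw [Finsupp.inf_apply]
      by_cases h : c i = g i <;> grind
    · rintro rfl
      refine ⟨inf_le_left, fun i hi => ?_⟩
      have hi : ¬(x ⊓ g) i = g i := by simpa using hi
      rw [Finsupp.inf_apply] at hi ⊢
      grind
  have : Finite {c : Fin n →₀ ℕ // c ≤ g ∧ c ∈ exponents I \ exponents J} :=
    ((Set.finite_Iic g).subset fun c hc => hc.1 :
      {c | c ≤ g ∧ c ∈ exponents I \ exponents J}.Finite)
  refine HasConePartition.of_finite
    (ι := {c : Fin n →₀ ℕ // c ≤ g ∧ c ∈ exponents I \ exponents J})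
    (fun c => c.1) (fun c => {i | c.1 i = g i}) (fun x => ?_) (fun c d x hc hd => ?_)
    fun _ => Nat.zero_le _
  · constructor
    · intro hx
      exact ⟨⟨x ⊓ g, inf_le_right, (hg x).1 hx⟩, (hcone _ inf_le_right x).2 rfl⟩
    · rintro ⟨⟨c, hc, hcU⟩, hx⟩
      rw [hcone c hc] at hx
      rw [hg, hx]
      exact hcU
  · rw [hcone _ c.2.1] at hc
    rw [hcone _ d.2.1] at hd
    exact Subtype.ext (hc.symm.trans hd)

theorem natCast_le_sdepth_iff {K : Type*} [Field K] {n : ℕ}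
    {I J : Ideal (MvPolynomial (Fin n) K)} (hI : IsMonomialIdeal I) (hJ : IsMonomialIdeal J)
    (d : ℕ) : (d : ℕ∞) ≤ sdepth K I J ↔ HasConePartition (exponents I \ exponents J) d := by
  constructor
  · intro h
    rcases Nat.eq_zero_or_pos d with rfl | hd
    · exact hasConePartition_zero hI hJ
    · have hlt : ((d - 1 : ℕ) : ℕ∞) < sdepth K I J :=
        lt_of_lt_of_le (by exact_mod_cast Nat.sub_lt hd one_pos) h
      obtain ⟨e, ⟨r, a, Z, hdec, hc⟩, he⟩ := lt_sSup_iff.1 hlt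
      obtain ⟨hU, hdisj⟩ := isStanleyDecomp_iff.1 hdec
      refine ⟨r, a, Z, hU, hdisj, fun i => ?_⟩
      have : d - 1 < (Z i).card := by exact_mod_cast he.trans_le (hc i)
      omega
  · rintro ⟨r, a, Z, hU, hdisj, hc⟩
    exact le_sSup ⟨r, a, Z, isStanleyDecomp_iff.2 ⟨hU, hdisj⟩, fun i => by exact_mod_cast hc i⟩

theorem mem_stanleyCone_sup {n : ℕ} {a b x : Fin n →₀ ℕ} {Y Z : Finset (Fin n)}
    (h : (stanleyCone a Z ∩ stanleyCone b Y).Nonempty) :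
    x ∈ stanleyCone (a ⊔ b) (Z ∩ Y) ↔ x ∈ stanleyCone a Z ∧ x ∈ stanleyCone b Y := by
  obtain ⟨y, ⟨ha, hZ⟩, hb, hY⟩ := h
  simp only [stanleyCone, Set.mem_ofPred_eq, sup_le_iff, Finset.mem_inter, Finsupp.sup_apply,
    not_and_or]
  constructor
  · rintro ⟨⟨hax, hbx⟩, hx⟩
    refine ⟨⟨hax, fun i hi => ?_⟩, hbx, fun i hi => ?_⟩
    · have := hx i (.inl hi)
      have := hZ i hi
      have := hb i
      grind
    · have := hx i (.inr hi)
      have := hY i hi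
      have := ha i
      grind
  · rintro ⟨⟨hax, hxZ⟩, hbx, hxY⟩
    refine ⟨⟨hax, hbx⟩, ?_⟩
    rintro i (hi | hi)
    · have := hxZ i hi
      have := hbx i
      grind
    · have := hxY i hi
      have := hax i
      grind

theorem HasConePartition.inter {n d e f : ℕ} {U V : Set (Fin n →₀ ℕ)}
    (hU : HasConePartition U d) (hV : HasConePartition V e) (hf : f + n ≤ d + e) :
    HasConePartition (U ∩ V) f := by
  obtain ⟨r, a, Z, hU, hUd, hUc⟩ := hU
  obtain ⟨t, b, Y, hV, hVd, hVc⟩ := hV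
  refine HasConePartition.of_finite
    (ι := {p : Fin r × Fin t //
      (stanleyCone (a p.1) (Z p.1) ∩ stanleyCone (b p.2) (Y p.2)).Nonempty})
    (fun p => a p.1.1 ⊔ b p.1.2) (fun p => Z p.1.1 ∩ Y p.1.2) (fun x => ?_)
    (fun p q x hp hq => ?_) fun p => ?_
  · constructor
    · rintro ⟨hxU, hxV⟩
      obtain ⟨i, hi⟩ := (hU x).1 hxU
      obtain ⟨j, hj⟩ := (hV x).1 hxV
      exact ⟨⟨(i, j), x, hi, hj⟩, (mem_stanleyCone_sup ⟨x, hi, hj⟩).2 ⟨hi, hj⟩⟩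
    · rintro ⟨p, hx⟩
      rw [mem_stanleyCone_sup p.2] at hx
      exact ⟨(hU x).2 ⟨_, hx.1⟩, (hV x).2 ⟨_, hx.2⟩⟩
  · rw [mem_stanleyCone_sup p.2] at hp
    rw [mem_stanleyCone_sup q.2] at hq
    exact Subtype.ext (Prod.ext (hUd _ _ x hp.1 hq.1) (hVd _ _ x hp.2 hq.2))
  · have h₁ := Finset.card_union_add_card_inter (Z p.1.1) (Y p.1.2)
    have h₂ := Finset.card_le_univ (Z p.1.1 ∪ Y p.1.2)
    rw [Fintype.card_fin] at h₂
    have := hUc p.1.1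
    have := hVc p.1.2
    omega

theorem HasConePartition.union {n d : ℕ} {U V : Set (Fin n →₀ ℕ)}
    (hU : HasConePartition U d) (hV : HasConePartition V d) (hUV : Disjoint U V) :
    HasConePartition (U ∪ V) d := by
  obtain ⟨r, a, Z, hU, hUd, hUc⟩ := hU
  obtain ⟨t, b, Y, hV, hVd, hVc⟩ := hV
  rw [Set.disjoint_left] at hUV
  refine HasConePartition.of_finite (Sum.elim a b) (Sum.elim Z Y) (fun x => ?_) ?_ ?_
  · rw [Set.mem_union, hU, hV, Sum.exists]
    rfl
  · rintro (i | i) (j | j) x hi hj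
    · rw [hUd i j x hi hj]
    · exact (hUV ((hU x).2 ⟨i, hi⟩) ((hV x).2 ⟨j, hj⟩)).elim
    · exact (hUV ((hU x).2 ⟨j, hj⟩) ((hV x).2 ⟨i, hi⟩)).elim
    · rw [hVd i j x hi hj]
  · rintro (i | i)
    · exact hUc i
    · exact hVc i

theorem mapDomain_le_iff_le_comapDomain {m n : ℕ} {f : Fin m → Fin n}
    (hf : Function.Injective f) {a : Fin m →₀ ℕ} {x : Fin n →₀ ℕ} :
    a.mapDomain f ≤ x ↔ a ≤ x.comapDomain f hf.injOn := by
  constructor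
  · intro h i
    simpa [Finsupp.mapDomain_apply hf] using h (f i)
  · intro h j
    by_cases hj : j ∈ Set.range f
    · obtain ⟨i, rfl⟩ := hj
      simpa [Finsupp.mapDomain_apply hf] using h i
    · simp [Finsupp.mapDomain_of_notMem_range _ _ hj]

theorem hasConePartition_comapDomain_iff {m n d : ℕ} {f : Fin m → Fin n}
    (hf : Function.Injective f) {V : Set (Fin m →₀ ℕ)} :
    HasConePartition {x : Fin n →₀ ℕ | x.comapDomain f hf.injOn ∈ V} d ↔
      HasConePartition V (d - (n - m)) := by
  classical
  set R : Finset (Fin n) := Finset.univ.image f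
  have hR : ∀ j, j ∈ R ↔ j ∈ Set.range f := by simp [R]
  have hcR : Rᶜ.card = n - m := by
    rw [Finset.card_compl, Finset.card_image_of_injective _ hf]
    simp
  constructor
  · rintro ⟨r, a, Z, hU, hd, hc⟩
    have hcone : ∀ i, (∀ j ∉ R, a i j = 0) → ∀ y : Fin m →₀ ℕ,
        y ∈ stanleyCone ((a i).comapDomain f hf.injOn) ((Z i).preimage f hf.injOn) ↔
          y.mapDomain f ∈ stanleyCone (a i) (Z i) := by
      intro i hi y
      constructor
      · rintro ⟨h₁, h₂⟩
        refine ⟨fun j => ?_, fun j hj => ?_⟩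
        · by_cases hjR : j ∈ R
          · obtain ⟨k, rfl⟩ := (hR j).1 hjR
            simpa [Finsupp.mapDomain_apply hf] using h₁ k
          · simp [hi j hjR]
        · by_cases hjR : j ∈ R
          · obtain ⟨k, rfl⟩ := (hR j).1 hjR
            simpa [Finsupp.mapDomain_apply hf] using h₂ k (by simpa using hj)
          · rw [hi j hjR, Finsupp.mapDomain_of_notMem_range _ _ (mt (hR j).2 hjR)]
      · rintro ⟨h₁, h₂⟩
        refine ⟨fun k => ?_, fun k hk => ?_⟩
        · simpa [Finsupp.mapDomain_apply hf] using h₁ (f k)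
        · simpa [Finsupp.mapDomain_apply hf] using h₂ (f k) (by simpa using hk)
    have hV : ∀ y : Fin m →₀ ℕ, y ∈ V ↔ ∃ i, y.mapDomain f ∈ stanleyCone (a i) (Z i) := by
      intro y
      rw [← hU, Set.mem_ofPred_eq, Finsupp.comapDomain_mapDomain _ hf]
    refine HasConePartition.of_finite (ι := {i // ∀ j ∉ R, a i j = 0})
      (fun i => (a i.1).comapDomain f hf.injOn) (fun i => (Z i.1).preimage f hf.injOn)
      (fun y => ?_) (fun i j y hi hj => ?_) fun i => ?_
    · rw [hV]
      constructor
      · rintro ⟨i, hi⟩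
        have h0 : ∀ j ∉ R, a i j = 0 := by
          intro j hj
          have := hi.1 j
          rwa [Finsupp.mapDomain_of_notMem_range _ _ (mt (hR j).2 hj), Nat.le_zero] at this
        exact ⟨⟨i, h0⟩, (hcone i h0 y).2 hi⟩
      · rintro ⟨i, hi⟩
        exact ⟨i.1, (hcone i.1 i.2 y).1 hi⟩
    · exact Subtype.ext (hd _ _ _ ((hcone i.1 i.2 y).1 hi) ((hcone j.1 j.2 y).1 hj))
    · have hsub : Z i.1 ⊆ ((Z i.1).preimage f hf.injOn).image f ∪ Rᶜ := by
        intro j hj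
        by_cases hjR : j ∈ R
        · obtain ⟨k, rfl⟩ := (hR j).1 hjR
          simp [hj, hf.eq_iff]
        · simp [hjR]
      have h₁ := (Finset.card_le_card hsub).trans (Finset.card_union_le _ _)
      rw [hcR, Finset.card_image_of_injective _ hf] at h₁
      have := hc i.1
      omega
  · rintro ⟨r, a, Z, hU, hd, hc⟩
    have hcone : ∀ i, ∀ x : Fin n →₀ ℕ,
        x ∈ stanleyCone ((a i).mapDomain f) ((Z i).image f ∪ Rᶜ) ↔
          x.comapDomain f hf.injOn ∈ stanleyCone (a i) (Z i) := by
      intro i x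
      refine and_congr (mapDomain_le_iff_le_comapDomain hf)
        ⟨fun h k hk => ?_, fun h j hj => ?_⟩
      · simpa [Finsupp.mapDomain_apply hf] using h (f k) (by simp [R, hf.eq_iff, hk])
      · simp only [Finset.mem_union, not_or, Finset.mem_compl, not_not] at hj
        obtain ⟨k, rfl⟩ := (hR j).1 hj.2
        have hk : k ∉ Z i := fun hk => hj.1 (Finset.mem_image_of_mem f hk)
        simpa [Finsupp.mapDomain_apply hf] using h k hk
    refine ⟨r, fun i => (a i).mapDomain f, fun i => (Z i).image f ∪ Rᶜ, fun x => ?_,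
      fun i j x hi hj => ?_, fun i => ?_⟩
    · simp only [hcone]
      exact hU _
    · exact hd _ _ _ ((hcone i x).1 hi) ((hcone j x).1 hj)
    · have hdisj : Disjoint ((Z i).image f) Rᶜ := by
        exact disjoint_compl_right.mono_left (Finset.image_subset_image (Finset.subset_univ _))
      rw [Finset.card_union_of_disjoint hdisj, hcR, Finset.card_image_of_injective _ hf]
      have := hc i
      omega

theorem extIdeal_span_monomial {K : Type*} [Field K] {m n : ℕ} (f : Fin m → Fin n)
    (G : Set (Fin m →₀ ℕ)) :
    extIdeal f (Ideal.span ((fun a => monomial a (1 : K)) '' G)) =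
      Ideal.span ((fun a => monomial a (1 : K)) '' (Finsupp.mapDomain f '' G)) := by
  rw [extIdeal, Ideal.map_span, Set.image_image, Set.image_image]
  simp only [rename_monomial]

theorem IsMonomialIdeal.extIdeal {K : Type*} [Field K] {m n : ℕ} (f : Fin m → Fin n)
    {I : Ideal (MvPolynomial (Fin m) K)} (hI : IsMonomialIdeal I) :
    IsMonomialIdeal (extIdeal f I) := by
  obtain ⟨G, rfl⟩ := hI
  exact ⟨_, extIdeal_span_monomial f G⟩

theorem exponents_extIdeal {K : Type*} [Field K] {m n : ℕ} {f : Fin m → Fin n}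
    (hf : Function.Injective f) {I : Ideal (MvPolynomial (Fin m) K)} (hI : IsMonomialIdeal I) :
    exponents (extIdeal f I) = {x | x.comapDomain f hf.injOn ∈ exponents I} := by
  obtain ⟨G, rfl⟩ := hI
  rw [extIdeal_span_monomial]
  ext x
  simp [exponents, mem_ideal_span_monomial_image,
    mapDomain_le_iff_le_comapDomain hf]

theorem IsMonomialIdeal.sup {K : Type*} [Field K] {n : ℕ}
    {I J : Ideal (MvPolynomial (Fin n) K)} (hI : IsMonomialIdeal I) (hJ : IsMonomialIdeal J) :
    IsMonomialIdeal (I ⊔ J) := by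
  obtain ⟨G, rfl⟩ := hI
  obtain ⟨H, rfl⟩ := hJ
  exact ⟨G ∪ H, by rw [Set.image_union, Ideal.span_union]⟩

theorem exponents_sup {K : Type*} [Field K] {n : ℕ}
    {I J : Ideal (MvPolynomial (Fin n) K)} (hI : IsMonomialIdeal I) (hJ : IsMonomialIdeal J) :
    exponents (I ⊔ J) = exponents I ∪ exponents J := by
  obtain ⟨G, rfl⟩ := hI
  obtain ⟨H, rfl⟩ := hJ
  rw [← Ideal.span_union, ← Set.image_union]
  ext x
  simp [exponents, mem_ideal_span_monomial_image, or_and_right, exists_or]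

theorem sdepth_extIdeal {K : Type*} [Field K] {m n : ℕ} {f : Fin m → Fin n}
    (hf : Function.Injective f) {I : Ideal (MvPolynomial (Fin m) K)} (hI : IsMonomialIdeal I) :
    sdepth K (extIdeal f I) ⊥ = sdepth K I ⊥ + (n - m : ℕ) := by
  refine ENat.eq_of_forall_natCast_le_iff fun d => ?_
  rw [natCast_le_sdepth_iff (hI.extIdeal f) isMonomialIdeal_bot, ← tsub_le_iff_right,
    ← ENat.natCast_sub, natCast_le_sdepth_iff hI isMonomialIdeal_bot, exponents_extIdeal hf hI]
  simp only [exponents_bot, Set.sdiff_empty]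
  exact hasConePartition_comapDomain_iff hf

theorem sdepth_quotient_extIdeal {K : Type*} [Field K] {m n : ℕ} {f : Fin m → Fin n}
    (hf : Function.Injective f) {I : Ideal (MvPolynomial (Fin m) K)} (hI : IsMonomialIdeal I) :
    sdepth K ⊤ (extIdeal f I) = sdepth K ⊤ I + (n - m : ℕ) := by
  refine ENat.eq_of_forall_natCast_le_iff fun d => ?_
  rw [natCast_le_sdepth_iff isMonomialIdeal_top (hI.extIdeal f), ← tsub_le_iff_right,
    ← ENat.natCast_sub, natCast_le_sdepth_iff isMonomialIdeal_top hI, exponents_extIdeal hf hI]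
  simp only [exponents_top, ← Set.compl_eq_univ_sdiff]
  exact hasConePartition_comapDomain_iff hf (V := (exponents I)ᶜ)

theorem ENat.exists_natCast_add_of_le_add {B C : ℕ∞} {k : ℕ} (h : (k : ℕ∞) ≤ B + C) :
    ∃ b c : ℕ, (b : ℕ∞) ≤ B ∧ (c : ℕ∞) ≤ C ∧ k ≤ b + c := by
  induction B using ENat.recTopCoe with
  | top => exact ⟨k, 0, le_top, by simp, by simp⟩
  | coe b =>
    induction C using ENat.recTopCoe with
    | top => exact ⟨0, k, by simp, le_top, by simp⟩
    | coe c => exact ⟨b, c, le_rfl, le_rfl, by exact_mod_cast h⟩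

theorem min_sdepth_le_sdepth_sup {K : Type*} [Field K] {n : ℕ}
    {I J : Ideal (MvPolynomial (Fin n) K)} (hI : IsMonomialIdeal I) (hJ : IsMonomialIdeal J) :
    min (sdepth K I ⊥) (sdepth K J ⊥ + sdepth K ⊤ I - (n : ℕ∞)) ≤ sdepth K (I ⊔ J) ⊥ := by
  refine ENat.forall_natCast_le_iff_le.1 fun d hd => ?_
  rcases Nat.eq_zero_or_pos d with rfl | hpos
  · simp
  obtain ⟨hdI, hdJ⟩ := le_min_iff.1 hd
  have hadd : ((d + n : ℕ) : ℕ∞) ≤ sdepth K J ⊥ + sdepth K ⊤ I := by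
    have hlt : ((d - 1 : ℕ) : ℕ∞) < sdepth K J ⊥ + sdepth K ⊤ I - (n : ℕ∞) :=
      lt_of_lt_of_le (by exact_mod_cast Nat.sub_lt hpos one_pos) hdJ
    have h := Order.add_one_le_of_lt (lt_tsub_iff_right.1 hlt)
    refine le_trans ?_ h
    norm_cast
    omega
  obtain ⟨b, c, hb, hc, hbc⟩ := ENat.exists_natCast_add_of_le_add hadd
  rw [natCast_le_sdepth_iff hI isMonomialIdeal_bot] at hdI
  rw [natCast_le_sdepth_iff hJ isMonomialIdeal_bot] at hb
  rw [natCast_le_sdepth_iff isMonomialIdeal_top hI] at hc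
  rw [natCast_le_sdepth_iff (hI.sup hJ) isMonomialIdeal_bot, exponents_sup hI hJ]
  simp only [exponents_bot, exponents_top, Set.sdiff_empty, ← Set.compl_eq_univ_sdiff] at *
  have := hdI.union (hb.inter hc hbc)
    (Set.disjoint_left.2 fun x hx hx' => hx'.2 hx)
  rwa [← Set.sdiff_eq, Set.union_sdiff_self] at this

theorem midEmbed_injective {n s : ℕ} (hs : 1 ≤ s) (hsn : s ≤ n) :
    Function.Injective (midEmbed hs hsn) := by
  intro i j h
  simp only [midEmbed, Fin.mk.injEq] at h
  exact Fin.ext (by omega)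

/-- Let `1 ≤ s ≤ r+1 ≤ n`, `n ≥ 2`, `p = r - s + 1`,
`S' = K[x_1,…,x_r]`, `S'' = K[x_s,…,x_n]`, and `I ⊂ S'`, `J ⊂ S''` monomial ideals.
Then `sdepth_S(IS + JS) ≥ min(sdepth_S(IS), sdepth_{S''}(J) + sdepth_{S'}(S'/I) - p)
= min(sdepth_S(IS), sdepth_S(JS) + sdepth_S(S/IS) - n)`. -/
theorem sdepth_sup_general {K : Type*} [Field K] {n r s : ℕ}
    (hs : 1 ≤ s) (hsr : s ≤ r + 1) (hrn : r + 1 ≤ n) (hn : 2 ≤ n)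
    (I : Ideal (MvPolynomial (Fin r) K)) (J : Ideal (MvPolynomial (Fin (n + 1 - s)) K))
    (hmI : IsMonomialIdeal I) (hmJ : IsMonomialIdeal J)
    (hI0 : I ≠ ⊥) (hI1 : I ≠ ⊤) (hJ0 : J ≠ ⊥) (hJ1 : J ≠ ⊤) :
    sdepth K (extIdeal (Fin.castLE (by omega : r ≤ n)) I ⊔
        extIdeal (midEmbed hs (by omega : s ≤ n)) J) ⊥ ≥
      min (sdepth K (extIdeal (Fin.castLE (by omega : r ≤ n)) I) ⊥)
        (sdepth K J ⊥ + sdepth K ⊤ I - ((r + 1 - s : ℕ) : ℕ∞)) ∧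
    min (sdepth K (extIdeal (Fin.castLE (by omega : r ≤ n)) I) ⊥)
        (sdepth K J ⊥ + sdepth K ⊤ I - ((r + 1 - s : ℕ) : ℕ∞)) =
      min (sdepth K (extIdeal (Fin.castLE (by omega : r ≤ n)) I) ⊥)
        (sdepth K (extIdeal (midEmbed hs (by omega : s ≤ n)) J) ⊥ +
          sdepth K ⊤ (extIdeal (Fin.castLE (by omega : r ≤ n)) I) - (n : ℕ∞)) := by
  have hf := Fin.castLE_injective (by omega : r ≤ n)
  have hg := midEmbed_injective hs (by omega : s ≤ n)
  have heq : sdepth K (extIdeal (midEmbed hs (by omega : s ≤ n)) J) ⊥ +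
      sdepth K ⊤ (extIdeal (Fin.castLE (by omega : r ≤ n)) I) - (n : ℕ∞) =
      sdepth K J ⊥ + sdepth K ⊤ I - ((r + 1 - s : ℕ) : ℕ∞) := by
    set k := (n - (n + 1 - s)) + (n - r) with hk
    have hn' : (n : ℕ∞) = ((r + 1 - s : ℕ) : ℕ∞) + (k : ℕ) := by
      norm_cast
      omega
    rw [sdepth_extIdeal hg hmJ, sdepth_quotient_extIdeal hf hmI, add_add_add_comm,
      ← Nat.cast_add, ← hk, hn', add_comm ((r + 1 - s : ℕ) : ℕ∞), ← tsub_tsub,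
      (ENat.addLECancellable_natCast k).add_tsub_cancel_right]
  rw [heq]
  refine ⟨?_, rfl⟩
  rw [ge_iff_le, ← heq]
  exact min_sdepth_le_sdepth_sup (hmI.extIdeal _) (hmJ.extIdeal _)
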